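/- arXiv:1901.09561 — 2 statements merged into one kernel-verified Lean document; each statement's English description precedes it below -/
import Mathlib

section
/- Araki–Lieb inequality: for any density matrix Γ on H₁ ⊗ H₂ (finite dimensional), S(Γ) ≥ |S(Γ¹) − S(Γ²)|, where Γ¹, Γ² are the partial traces and S the von Neumann entropy. -/
open Matrix Kronecker
open scoped ComplexOrder

variable {n m : Type*} [Fintype n] [DecidableEq n] [Fintype m] [DecidableEq m]

/-- Matrix logarithm via the functional calculus of Hermitian matrices
(junk value `0` for non-Hermitian input). -/
noncomputable def mlog {k : Type*} [Fintype k] [DecidableEq k] (A : Matrix k k ℂ) :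
    Matrix k k ℂ :=
  if hA : A.IsHermitian then hA.cfc Real.log else 0

/-- Von Neumann entropy `S(ρ) = -tr (ρ log ρ)`. -/
noncomputable def vNEntropy {k : Type*} [Fintype k] [DecidableEq k] (A : Matrix k k ℂ) : ℝ :=
  -(Matrix.trace (A * mlog A)).re

/-- Quantum relative entropy `H(ρ, σ) = tr (ρ (log ρ - log σ))`. -/
noncomputable def relEntropy {k : Type*} [Fintype k] [DecidableEq k] (ρ σ : Matrix k k ℂ) : ℝ :=
  (Matrix.trace (ρ * (mlog ρ - mlog σ))).re

/-- Partial trace over the second factor. -/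
noncomputable def ptrace₂ {a b : Type*} [Fintype b] (Γ : Matrix (a × b) (a × b) ℂ) :
    Matrix a a ℂ :=
  Matrix.of fun x x' => ∑ y : b, Γ (x, y) (x', y)

/-- Partial trace over the first factor. -/
noncomputable def ptrace₁ {a b : Type*} [Fintype a] (Γ : Matrix (a × b) (a × b) ℂ) :
    Matrix b b ℂ :=
  Matrix.of fun y y' => ∑ x : a, Γ (x, y) (x, y')

/-- A density matrix: positive semidefinite with unit trace. -/
def IsDensityMatrix {k : Type*} [Fintype k] (ρ : Matrix k k ℂ) : Prop :=
  ρ.PosSemidef ∧ Matrix.trace ρ = 1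

/-- The Shannon entropy of a joint distribution is at most the sum of those of its marginals. -/
theorem sum_negMulLog_le_marginals {a b : Type*} [Fintype a] [Fintype b] (p : a × b → ℝ)
    (hp : ∀ i, 0 ≤ p i) (h1 : ∑ i, p i = 1) :
    ∑ i, Real.negMulLog (p i) ≤
      ∑ x, Real.negMulLog (∑ y, p (x, y)) + ∑ y, Real.negMulLog (∑ x, p (x, y)) := by
  set r : a → ℝ := fun x => ∑ y, p (x, y) with hr
  set s : b → ℝ := fun y => ∑ x, p (x, y) with hs
  have hr1 : ∑ x, r x = 1 := by rw [← h1, Fintype.sum_prod_type]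
  have hs1 : ∑ y, s y = 1 := by rw [← h1, Fintype.sum_prod_type_right]
  have hr0 : ∀ x, 0 ≤ r x := fun x => Finset.sum_nonneg fun y _ => hp _
  have hs0 : ∀ y, 0 ≤ s y := fun y => Finset.sum_nonneg fun x _ => hp _
  have key : ∀ i : a × b, Real.negMulLog (p i) ≤
      -(p i * Real.log (r i.1)) - p i * Real.log (s i.2) + r i.1 * s i.2 - p i := by
    rintro ⟨x, y⟩
    have hpr : p (x, y) ≤ r x :=
      Finset.single_le_sum (f := fun y => p (x, y)) (fun y _ => hp _) (Finset.mem_univ y)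
    have hps : p (x, y) ≤ s y :=
      Finset.single_le_sum (f := fun x => p (x, y)) (fun x _ => hp _) (Finset.mem_univ x)
    rcases (hp (x, y)).eq_or_lt with h | h
    · simpa [← h] using mul_nonneg (hr0 x) (hs0 y)
    · have hrx := h.trans_le hpr
      have hsy := h.trans_le hps
      have hlog := Real.log_le_sub_one_of_pos (div_pos (mul_pos hrx hsy) h)
      rw [Real.log_div (mul_pos hrx hsy).ne' h.ne', Real.log_mul hrx.ne' hsy.ne'] at hlog
      have hmul := mul_le_mul_of_nonneg_left hlog h.le
      rw [mul_sub _ _ (1 : ℝ), mul_div_cancel₀ _ h.ne'] at hmul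
      simp only [Real.negMulLog]
      linarith
  refine (Finset.sum_le_sum fun i _ => key i).trans (le_of_eq ?_)
  have e1 : ∑ i : a × b, p i * Real.log (r i.1) = ∑ x, r x * Real.log (r x) := by
    simp only [Fintype.sum_prod_type, ← Finset.sum_mul, hr]
  have e2 : ∑ i : a × b, p i * Real.log (s i.2) = ∑ y, s y * Real.log (s y) := by
    simp only [Fintype.sum_prod_type_right, ← Finset.sum_mul, hs]
  have e3 : ∑ i : a × b, r i.1 * s i.2 = 1 := by
    rw [Fintype.sum_prod_type, ← Fintype.sum_mul_sum, hr1, hs1, one_mul]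
  simp only [Finset.sum_sub_distrib, Finset.sum_add_distrib, Finset.sum_neg_distrib, e1, e2, e3,
    h1, Real.negMulLog, neg_mul]
  ring

section Entropy

variable {k l : Type*} [Fintype k] [DecidableEq k] [Fintype l] [DecidableEq l]

theorem vNEntropy_eq_sum_eigenvalues {A : Matrix k k ℂ} (hA : A.IsHermitian) :
    vNEntropy A = ∑ i, Real.negMulLog (hA.eigenvalues i) := by
  have h : (A * mlog A).trace =
      ∑ i, (hA.eigenvalues i : ℂ) * (Real.log (hA.eigenvalues i) : ℂ) := by
    rw [mlog, dif_pos hA, IsHermitian.cfc]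
    nth_rewrite 1 [hA.spectral_theorem]
    rw [← map_mul, diagonal_mul_diagonal, Unitary.conjStarAlgAut_apply, trace_mul_cycle]
    simp [trace_diagonal]
  rw [vNEntropy, h, Complex.re_sum, ← Finset.sum_neg_distrib]
  refine Finset.sum_congr rfl fun i _ => ?_
  rw [← Complex.ofReal_mul, Complex.ofReal_re, Real.negMulLog, neg_mul]

theorem vNEntropy_eq_sum_roots {A : Matrix k k ℂ} (hA : A.IsHermitian) :
    vNEntropy A = (A.charpoly.roots.map fun z : ℂ => Real.negMulLog z.re).sum := by
  rw [vNEntropy_eq_sum_eigenvalues hA, hA.roots_charpoly_eq_eigenvalues, Multiset.map_map]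
  rfl

theorem vNEntropy_congr_charpoly {A : Matrix k k ℂ} {B : Matrix l l ℂ} (hA : A.IsHermitian)
    (hB : B.IsHermitian) (h : A.charpoly = B.charpoly) : vNEntropy A = vNEntropy B := by
  rw [vNEntropy_eq_sum_roots hA, vNEntropy_eq_sum_roots hB, h]

theorem vNEntropy_mul_conjTranspose_self (M : Matrix k l ℂ) :
    vNEntropy (M * Mᴴ) = vNEntropy (Mᴴ * M) := by
  rw [vNEntropy_eq_sum_roots (isHermitian_mul_conjTranspose_self M),
    vNEntropy_eq_sum_roots (isHermitian_conjTranspose_mul_self M)]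
  have h₁ := (charpoly_monic (M * Mᴴ)).ne_zero
  have h₂ := (charpoly_monic (Mᴴ * M)).ne_zero
  have h := congrArg (fun q : Polynomial ℂ => (q.roots.map fun z : ℂ => Real.negMulLog z.re).sum)
    (charpoly_mul_comm' M Mᴴ)
  have hX : ∀ (d : ℕ) (q : Polynomial ℂ), q ≠ 0 →
      ((Polynomial.X ^ d * q).roots.map fun z : ℂ => Real.negMulLog z.re).sum =
        (q.roots.map fun z : ℂ => Real.negMulLog z.re).sum := fun d q hq => by
    rw [Polynomial.roots_mul (mul_ne_zero (pow_ne_zero _ Polynomial.X_ne_zero) hq),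
      Polynomial.roots_pow, Polynomial.roots_X, Multiset.map_add, Multiset.sum_add,
      Multiset.map_nsmul, Multiset.sum_nsmul]
    simp
  simpa only [hX _ _ h₁, hX _ _ h₂] using h

/-- The two marginals of the pure state with amplitudes `M` have the same entropy. -/
theorem vNEntropy_transpose_mul_conjTranspose (M : Matrix k l ℂ) :
    vNEntropy (Mᵀ * Mᵀᴴ) = vNEntropy (M * Mᴴ) := by
  rw [vNEntropy_mul_conjTranspose_self M]
  refine vNEntropy_congr_charpoly (isHermitian_mul_conjTranspose_self Mᵀ)
    (isHermitian_conjTranspose_mul_self M) ?_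
  have h : Mᴴᵀ = Mᵀᴴ := rfl
  rw [← charpoly_transpose (Mᴴ * M), transpose_mul, h]

/-- Measuring in the standard basis does not decrease the entropy. -/
theorem vNEntropy_le_sum_diag {A : Matrix k k ℂ} (hA : A.PosSemidef) :
    vNEntropy A ≤ ∑ i, Real.negMulLog (A i i).re := by
  set W : Matrix k k ℂ := ↑hA.1.eigenvectorUnitary with hW
  set e := hA.1.eigenvalues with he
  have hdiag : ∀ i, (A i i).re = ∑ j, Complex.normSq (W i j) * e j := by
    intro i
    have h : A = W * diagonal (RCLike.ofReal ∘ e) * star W := by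
      conv_lhs => rw [hA.1.spectral_theorem, Unitary.conjStarAlgAut_apply]
    rw [h, mul_apply, Complex.re_sum]
    refine Finset.sum_congr rfl fun j _ => ?_
    rw [mul_diagonal, star_apply]
    simp [Complex.normSq_apply]
    ring
  have hrow : ∀ i, ∑ j, Complex.normSq (W i j) = 1 := by
    intro i
    have hu : W * star W = 1 := Unitary.coe_mul_star_self hA.1.eigenvectorUnitary
    have h := congrArg (fun B : Matrix k k ℂ => (B i i).re) hu
    simpa [mul_apply, star_apply, Complex.normSq_apply] using h
  have hcol : ∀ j, ∑ i, Complex.normSq (W i j) = 1 := by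
    intro j
    have hu : star W * W = 1 := Unitary.coe_star_mul_self hA.1.eigenvectorUnitary
    have h := congrArg (fun B : Matrix k k ℂ => (B j j).re) hu
    simpa [mul_apply, star_apply, Complex.normSq_apply] using h
  calc vNEntropy A = ∑ j, Real.negMulLog (e j) := vNEntropy_eq_sum_eigenvalues hA.1
    _ = ∑ j, ∑ i, Complex.normSq (W i j) * Real.negMulLog (e j) := by
        simp only [← Finset.sum_mul, hcol, one_mul]
    _ = ∑ i, ∑ j, Complex.normSq (W i j) * Real.negMulLog (e j) := Finset.sum_comm
    _ ≤ ∑ i, Real.negMulLog (A i i).re := by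
        refine Finset.sum_le_sum fun i _ => ?_
        rw [hdiag]
        exact Real.concaveOn_negMulLog.le_map_sum (fun j _ => Complex.normSq_nonneg _) (hrow i)
          fun j _ => hA.eigenvalues_nonneg j

end Entropy

open scoped MatrixOrder Matrix.Norms.L2Operator in
theorem Matrix.PosSemidef.exists_eq_mul_conjTranspose_self {k : Type*} [Fintype k]
    [DecidableEq k] {A : Matrix k k ℂ} (hA : A.PosSemidef) : ∃ X : Matrix k k ℂ, A = X * Xᴴ :=
  CStarAlgebra.nonneg_iff_eq_mul_star_self.1 hA.nonneg

section PartialTrace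

variable {a b : Type*} [Fintype a] [Fintype b]

theorem ptrace₂_submatrix_swap {a b : Type*} [Fintype a] (M : Matrix (a × b) (a × b) ℂ) :
    ptrace₂ (M.submatrix Prod.swap Prod.swap) = ptrace₁ M := rfl

theorem trace_ptrace₂ (M : Matrix (a × b) (a × b) ℂ) : (ptrace₂ M).trace = M.trace := by
  simp [ptrace₂, trace, Fintype.sum_prod_type]

theorem ptrace₂_kronecker_mul_mul_kronecker [DecidableEq b] (A C : Matrix a a ℂ) {B D : Matrix b b ℂ}
    (hDB : D * B = 1) (M : Matrix (a × b) (a × b) ℂ) :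
    ptrace₂ ((A ⊗ₖ B) * M * (C ⊗ₖ D)) = A * ptrace₂ M * C := by
  have hsum : ∀ v v' : b, ∑ y, B y v * D v' y = if v' = v then 1 else 0 := by
    intro v v'
    rw [← one_apply, ← hDB, mul_apply]
    exact Finset.sum_congr rfl fun y _ => mul_comm _ _
  ext x x'
  calc ptrace₂ ((A ⊗ₖ B) * M * (C ⊗ₖ D)) x x'
      = ∑ y, ∑ u', ∑ v', ∑ u, ∑ v,
          (A x u * M (u, v) (u', v') * C u' x') * (B y v * D v' y) := by
        simp only [ptrace₂, of_apply, mul_apply, kroneckerMap_apply, Fintype.sum_prod_type,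
          Finset.sum_mul]
        refine Finset.sum_congr rfl fun y _ => Finset.sum_congr rfl fun u' _ =>
          Finset.sum_congr rfl fun v' _ => Finset.sum_congr rfl fun u _ =>
          Finset.sum_congr rfl fun v _ => by ring
    _ = ∑ u', ∑ v', ∑ u, ∑ v,
          (A x u * M (u, v) (u', v') * C u' x') * ∑ y, B y v * D v' y := by
        simp only [Finset.mul_sum]
        rw [Finset.sum_comm]
        refine Finset.sum_congr rfl fun u' _ => ?_
        rw [Finset.sum_comm]
        refine Finset.sum_congr rfl fun v' _ => ?_
        rw [Finset.sum_comm]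
        refine Finset.sum_congr rfl fun u _ => ?_
        rw [Finset.sum_comm]
    _ = (A * ptrace₂ M * C) x x' := by
        simp only [hsum, ptrace₂, of_apply, mul_apply, Finset.sum_mul, Finset.mul_sum, mul_ite,
          mul_one, mul_zero, Finset.sum_ite_eq, Finset.mem_univ, if_true]
        exact Finset.sum_congr rfl fun u' _ => Finset.sum_comm

theorem ptrace₁_kronecker_mul_mul_kronecker [DecidableEq a] {A C : Matrix a a ℂ} (hCA : C * A = 1)
    (B D : Matrix b b ℂ) (M : Matrix (a × b) (a × b) ℂ) :
    ptrace₁ ((A ⊗ₖ B) * M * (C ⊗ₖ D)) = B * ptrace₁ M * D := by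
  have hswap : ∀ (P : Matrix a a ℂ) (Q : Matrix b b ℂ),
      (P ⊗ₖ Q).submatrix Prod.swap Prod.swap = Q ⊗ₖ P := by
    intro P Q
    ext i j
    exact mul_comm _ _
  rw [← ptrace₂_submatrix_swap, ← ptrace₂_submatrix_swap,
    ← ptrace₂_kronecker_mul_mul_kronecker B D hCA, ← hswap, ← hswap]
  congr 1
  change _ = _ * M.submatrix (Equiv.prodComm b a) (Equiv.prodComm b a) * _
  change (_ : Matrix (a × b) (a × b) ℂ).submatrix (Equiv.prodComm b a) (Equiv.prodComm b a) =
    (_ : Matrix (a × b) (a × b) ℂ).submatrix (Equiv.prodComm b a) (Equiv.prodComm b a) * _ *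
    (_ : Matrix (a × b) (a × b) ℂ).submatrix (Equiv.prodComm b a) (Equiv.prodComm b a)
  rw [submatrix_mul_equiv, submatrix_mul_equiv]

theorem isHermitian_ptrace₂ {a b : Type*} [Fintype b] {M : Matrix (a × b) (a × b) ℂ} (hM : M.IsHermitian) :
    (ptrace₂ M).IsHermitian := by
  ext x x'
  simp only [conjTranspose_apply, ptrace₂, of_apply, star_sum, hM.apply]

theorem isHermitian_ptrace₁ {a b : Type*} [Fintype a] {M : Matrix (a × b) (a × b) ℂ} (hM : M.IsHermitian) :
    (ptrace₁ M).IsHermitian :=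
  isHermitian_ptrace₂ (hM.submatrix Prod.swap)

variable [DecidableEq a] [DecidableEq b]

/-- Subadditivity of the von Neumann entropy. -/
theorem vNEntropy_le_ptrace_add_ptrace {M : Matrix (a × b) (a × b) ℂ}
    (hM : IsDensityMatrix M) :
    vNEntropy M ≤ vNEntropy (ptrace₂ M) + vNEntropy (ptrace₁ M) := by
  have h₂ := isHermitian_ptrace₂ hM.1.1
  have h₁ := isHermitian_ptrace₁ hM.1.1
  set U : Matrix a a ℂ := ↑h₂.eigenvectorUnitary with hU
  set V : Matrix b b ℂ := ↑h₁.eigenvectorUnitary with hV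
  have hUU : U * Uᴴ = 1 := Unitary.coe_mul_star_self h₂.eigenvectorUnitary
  have hVV : V * Vᴴ = 1 := Unitary.coe_mul_star_self h₁.eigenvectorUnitary
  set N := (Uᴴ ⊗ₖ Vᴴ) * M * (U ⊗ₖ V) with hN
  have hWW : (U ⊗ₖ V) * (Uᴴ ⊗ₖ Vᴴ) = 1 := by
    rw [← mul_kronecker_mul, hUU, hVV, one_kronecker_one]
  have hNpos : N.PosSemidef := by
    have h := hM.1.conjTranspose_mul_mul_same (U ⊗ₖ V)
    rwa [conjTranspose_kronecker] at h
  have hNM : vNEntropy N = vNEntropy M := by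
    refine vNEntropy_congr_charpoly hNpos.1 hM.1.1 ?_
    rw [hN, charpoly_mul_comm, ← mul_assoc, hWW, one_mul]
  have hNtr : N.trace = 1 := by
    rw [hN, trace_mul_comm, ← mul_assoc, hWW, one_mul, hM.2]
  have hN₂ : ptrace₂ N = diagonal (RCLike.ofReal ∘ h₂.eigenvalues) := by
    rw [hN, ptrace₂_kronecker_mul_mul_kronecker _ _ hVV,
      ← h₂.conjStarAlgAut_star_eigenvectorUnitary, Unitary.conjStarAlgAut_star_apply]
    rfl
  have hN₁ : ptrace₁ N = diagonal (RCLike.ofReal ∘ h₁.eigenvalues) := by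
    rw [hN, ptrace₁_kronecker_mul_mul_kronecker hUU,
      ← h₁.conjStarAlgAut_star_eigenvectorUnitary, Unitary.conjStarAlgAut_star_apply]
    rfl
  have hm₂ : ∀ x, ∑ y, (N (x, y) (x, y)).re = h₂.eigenvalues x := by
    intro x
    have h := congrArg (fun B : Matrix a a ℂ => (B x x).re) hN₂
    simpa [ptrace₂] using h
  have hm₁ : ∀ y, ∑ x, (N (x, y) (x, y)).re = h₁.eigenvalues y := by
    intro y
    have h := congrArg (fun B : Matrix b b ℂ => (B y y).re) hN₁
    simpa [ptrace₁] using h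
  rw [vNEntropy_eq_sum_eigenvalues h₂, vNEntropy_eq_sum_eigenvalues h₁, ← hNM]
  simp only [← hm₂, ← hm₁]
  refine (vNEntropy_le_sum_diag hNpos).trans
    (sum_negMulLog_le_marginals (fun i => (N i i).re) (fun i => ?_) ?_)
  · exact (Complex.le_def.1 (hNpos.diag_nonneg (i := i))).1
  · rw [← Complex.re_sum]
    exact congrArg Complex.re hNtr

theorem vNEntropy_ptrace₂_le {M : Matrix (a × b) (a × b) ℂ} (hM : IsDensityMatrix M) :
    vNEntropy (ptrace₂ M) ≤ vNEntropy (ptrace₁ M) + vNEntropy M := by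
  obtain ⟨X, rfl⟩ := hM.1.exists_eq_mul_conjTranspose_self
  -- the amplitudes of a purification of `M`, grouped as `a` against `b × (a × b)`
  set A : Matrix a (b × (a × b)) ℂ := of fun x z => X (x, z.1) z.2 with hA
  have e₁ : ptrace₂ (X * Xᴴ) = A * Aᴴ := by
    ext x x'
    simp [ptrace₂, mul_apply, hA, Fintype.sum_prod_type]
  have e₂ : ptrace₂ (Aᵀ * Aᵀᴴ) = ptrace₁ (X * Xᴴ) := by
    ext y y'
    simp only [ptrace₂, ptrace₁, mul_apply, hA, of_apply, transpose_apply, conjTranspose_apply]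
    exact Finset.sum_comm
  have e₃ : ptrace₁ (Aᵀ * Aᵀᴴ) = Xᵀ * Xᵀᴴ := by
    ext z z'
    simp only [ptrace₁, mul_apply, hA, of_apply, transpose_apply, conjTranspose_apply,
      Fintype.sum_prod_type_right]
  have hAT : Aᴴᵀ = Aᵀᴴ := rfl
  have hρ : IsDensityMatrix (Aᵀ * Aᵀᴴ) := by
    refine ⟨posSemidef_self_mul_conjTranspose _, ?_⟩
    rw [← hM.2, ← trace_ptrace₂ (X * Xᴴ), e₁, trace_mul_comm A, ← trace_transpose (Aᴴ * A),
      transpose_mul, hAT]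
  have h := vNEntropy_le_ptrace_add_ptrace hρ
  rwa [e₂, e₃, vNEntropy_transpose_mul_conjTranspose, vNEntropy_transpose_mul_conjTranspose,
    ← e₁] at h

end PartialTrace

/-- Araki–Lieb inequality. -/
theorem araki_lieb (Γ : Matrix (n × m) (n × m) ℂ) (hΓ : IsDensityMatrix Γ) :
    vNEntropy Γ ≥ |vNEntropy (ptrace₂ Γ) - vNEntropy (ptrace₁ Γ)| := by
  set Δ : Matrix (m × n) (m × n) ℂ := reindex (Equiv.prodComm n m) (Equiv.prodComm n m) Γ with hΔ
  have hswap : IsDensityMatrix Δ := by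
    refine ⟨hΓ.1.submatrix _, ?_⟩
    rw [← hΓ.2]
    exact (Equiv.prodComm m n).sum_comp fun i => Γ i i
  have hS : vNEntropy Δ = vNEntropy Γ :=
    vNEntropy_congr_charpoly hswap.1.1 hΓ.1.1 (charpoly_reindex (Equiv.prodComm n m) Γ)
  have e₂ : ptrace₂ Δ = ptrace₁ Γ := rfl
  have e₁ : ptrace₁ Δ = ptrace₂ Γ := rfl
  have h₁ := vNEntropy_ptrace₂_le hΓ
  have h₂ := vNEntropy_ptrace₂_le hswap
  rw [e₁, e₂, hS] at h₂
  exact abs_sub_le_iff.2 ⟨by linarith, by linarith⟩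
end

section
/- Monotonicity of mutual information under local measurement (via data processing): for a bipartite state Γ on H₁ ⊗ H₂ and a measurement Λ₂ on H₂, I(H₁:H₂)_{(1⊗Λ₂)Γ} ≤ I(H₁:H₂)_Γ. -/
open Matrix Kronecker
open scoped ComplexOrder

variable {n m : Type*} [Fintype n] [DecidableEq n] [Fintype m] [DecidableEq m]

section LogSums

open Filter Topology

lemma sum_log_sub_le_of_forall_pos {α β : Type*} [Fintype α] [Fintype β]
    (w p q : α → ℝ) (w' p' q' : β → ℝ)
    (hp : ∀ i, w i ≠ 0 → 0 < p i) (hq : ∀ i, w i ≠ 0 → 0 < q i)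
    (hp' : ∀ i, w' i ≠ 0 → 0 < p' i) (hq' : ∀ i, w' i ≠ 0 → 0 < q' i)
    (hsum : ∑ i, w' i = ∑ i, w i)
    (h : ∀ t : ℝ, 0 < t →
      ∑ i, w' i * (p' i / (q' i + t * p' i)) ≤ ∑ i, w i * (p i / (q i + t * p i))) :
    ∑ i, w' i * (Real.log (p' i) - Real.log (q' i)) ≤
      ∑ i, w i * (Real.log (p i) - Real.log (q i)) := by
  have deriv_term : ∀ w p q t : ℝ, 0 ≤ t → (w ≠ 0 → 0 < p) → (w ≠ 0 → 0 < q) →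
      HasDerivAt (fun t => w * Real.log (q + t * p)) (w * (p / (q + t * p))) t := by
    intro w p q t ht hp hq
    rcases eq_or_ne w 0 with rfl | hw
    · simpa using hasDerivAt_const t (0 : ℝ)
    · have hpos : 0 < q + t * p := by
        have := hp hw
        have := hq hw
        positivity
      have h1 : HasDerivAt (fun t : ℝ => q + t * p) p t := by
        simpa using ((hasDerivAt_id t).mul_const p).const_add q
      exact (h1.log hpos.ne').const_mul w
  have tendsto_term : ∀ w p q : ℝ, (w ≠ 0 → 0 < p) → (w ≠ 0 → 0 < q) →
      Tendsto (fun t => w * Real.log (q + t * p) - w * Real.log t) atTop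
        (𝓝 (w * Real.log p)) := by
    intro w p q hp hq
    rcases eq_or_ne w 0 with rfl | hw
    · simp
    · have h1 : Tendsto (fun t : ℝ => q / t + p) atTop (𝓝 p) := by
        simpa using (tendsto_const_nhds.div_atTop tendsto_id).add_const p
      refine ((h1.log (hp hw).ne').const_mul w).congr' ?_
      filter_upwards [eventually_gt_atTop 0] with t ht
      have hpos : 0 < q + t * p := by
        have := hp hw
        have := hq hw
        positivity
      rw [← mul_sub, ← Real.log_div hpos.ne' ht.ne']
      congr 2
      field_simp
  set F : ℝ → ℝ := fun t => ∑ i, w i * Real.log (q i + t * p i) -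
    ∑ i, w' i * Real.log (q' i + t * p' i) with hF
  have hderiv : ∀ t, 0 ≤ t → HasDerivAt F
      (∑ i, w i * (p i / (q i + t * p i)) - ∑ i, w' i * (p' i / (q' i + t * p' i))) t :=
    fun t ht => (HasDerivAt.fun_sum fun i _ => deriv_term _ _ _ t ht (hp i) (hq i)).sub
      (HasDerivAt.fun_sum fun i _ => deriv_term _ _ _ t ht (hp' i) (hq' i))
  have hmono : MonotoneOn F (Set.Ici 0) := by
    refine monotoneOn_of_deriv_nonneg (convex_Ici 0)
      (fun t ht => (hderiv t ht).continuousAt.continuousWithinAt) ?_ ?_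
    · intro t ht
      rw [interior_Ici] at ht
      exact (hderiv t (le_of_lt ht)).differentiableAt.differentiableWithinAt
    · intro t ht
      rw [interior_Ici] at ht
      rw [(hderiv t (le_of_lt ht)).deriv]
      exact sub_nonneg.2 (h t ht)
  have hlim : Tendsto F atTop
      (𝓝 (∑ i, w i * Real.log (p i) - ∑ i, w' i * Real.log (p' i))) := by
    refine ((tendsto_finsetSum Finset.univ fun i _ =>
      tendsto_term _ _ _ (hp i) (hq i)).sub (tendsto_finsetSum Finset.univ fun i _ =>
        tendsto_term _ _ _ (hp' i) (hq' i))).congr fun t => ?_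
    simp only [Finset.sum_sub_distrib, ← Finset.sum_mul, hsum, hF]
    ring
  have hle := ge_of_tendsto hlim ((eventually_ge_atTop 0).mono fun t ht =>
    hmono Set.self_mem_Ici ht ht)
  simp only [hF, zero_mul, add_zero] at hle
  simp only [mul_sub, Finset.sum_sub_distrib]
  linarith

end LogSums

lemma trace_conj_diagonal_mul_conj_diagonal {k : Type*} [Fintype k] [DecidableEq k]
    {U : Matrix k k ℂ} (hU : star U * U = 1) (p r : k → ℝ) :
    trace (U * diagonal (fun i => (p i : ℂ)) * star U *
      (U * diagonal (fun i => (r i : ℂ)) * star U)) = ∑ i, ((p i * r i : ℝ) : ℂ) := by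
  calc _ = trace (U * (diagonal (fun i => (p i : ℂ)) * (star U * U) *
          diagonal (fun i => (r i : ℂ))) * star U) := by
        simp only [Matrix.mul_assoc]
    _ = _ := by
        rw [trace_mul_cycle, hU, Matrix.mul_one, diagonal_mul_diagonal, Matrix.one_mul,
          trace_diagonal]
        simp only [Complex.ofReal_mul]

lemma exists_spectral {k : Type*} [Fintype k] [DecidableEq k] {A : Matrix k k ℂ}
    (hA : A.PosSemidef) :
    ∃ (U : Matrix k k ℂ) (p : k → ℝ), Uᴴ * U = 1 ∧ U * Uᴴ = 1 ∧
      A = U * diagonal (fun i => (p i : ℂ)) * Uᴴ ∧ (∀ i, 0 ≤ p i) ∧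
      vNEntropy A = -∑ i, p i * Real.log (p i) := by
  have hU : star (hA.1.eigenvectorUnitary : Matrix k k ℂ) * hA.1.eigenvectorUnitary = 1 :=
    Unitary.coe_star_mul_self _
  have hspec : A = hA.1.eigenvectorUnitary *
      diagonal (fun i => (hA.1.eigenvalues i : ℂ)) *
        star (hA.1.eigenvectorUnitary : Matrix k k ℂ) := by
    conv_lhs => rw [hA.1.spectral_theorem, Unitary.conjStarAlgAut_apply]
    rfl
  refine ⟨hA.1.eigenvectorUnitary, hA.1.eigenvalues, hU,
    Unitary.coe_mul_star_self _, hspec, hA.eigenvalues_nonneg, ?_⟩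
  have hlog : mlog A = hA.1.eigenvectorUnitary *
      diagonal (fun i => (Real.log (hA.1.eigenvalues i) : ℂ)) *
        star (hA.1.eigenvectorUnitary : Matrix k k ℂ) := by
    rw [mlog, dif_pos hA.1, IsHermitian.cfc, Unitary.conjStarAlgAut_apply]
    rfl
  have : trace (A * mlog A) =
      ∑ i, ((hA.1.eigenvalues i * Real.log (hA.1.eigenvalues i) : ℝ) : ℂ) := by
    rw [hlog]
    exact (congrArg (fun B => trace (B * _)) hspec).trans
      (trace_conj_diagonal_mul_conj_diagonal hU _ _)
  rw [vNEntropy, this, ← Complex.ofReal_sum, Complex.ofReal_re]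

section Variational

variable {k : Type*} [Fintype k]

/-- The quadratic functional whose supremum over `X` is the quasi-entropy
`∑ w p² / (q + t p)` of the pair `(ρ, σ)`. -/
noncomputable def quadFun (ρ σ : Matrix k k ℂ) (t : ℝ) (X : Matrix k k ℂ) : ℝ :=
  2 * (trace (ρ * X)).re - (trace (X * σ * Xᴴ)).re - t * (trace (Xᴴ * ρ * X)).re

lemma quadFun_spectral [DecidableEq k] {U V : Matrix k k ℂ} (hU : Uᴴ * U = 1)
    (hV : Vᴴ * V = 1) (p q : k → ℝ) (t : ℝ) (Z : Matrix k k ℂ) :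
    quadFun (U * diagonal (fun i => (p i : ℂ)) * Uᴴ) (V * diagonal (fun i => (q i : ℂ)) * Vᴴ) t
      (U * Z * Vᴴ) =
    ∑ i, ∑ j, (2 * p i * (Z i j * (starRingEnd ℂ) ((Uᴴ * V) i j)).re -
      (q j + t * p i) * Complex.normSq (Z i j)) := by
  have h1 : trace (U * diagonal (fun i => (p i : ℂ)) * Uᴴ * (U * Z * Vᴴ)) =
      trace (diagonal (fun i => (p i : ℂ)) * Z * (Uᴴ * V)ᴴ) := by
    calc _ = trace (U * (diagonal (fun i => (p i : ℂ)) * (Uᴴ * U) * (Z * Vᴴ))) := by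
          simp only [Matrix.mul_assoc]
      _ = _ := by
          rw [trace_mul_comm, hU]
          simp only [Matrix.mul_assoc, Matrix.mul_one, conjTranspose_mul,
            conjTranspose_conjTranspose]
  have h2 : trace (U * Z * Vᴴ * (V * diagonal (fun i => (q i : ℂ)) * Vᴴ) * (U * Z * Vᴴ)ᴴ) =
      trace (Z * diagonal (fun i => (q i : ℂ)) * Zᴴ) := by
    calc _ = trace (U * (Z * (Vᴴ * V) * diagonal (fun i => (q i : ℂ)) * (Vᴴ * V) * Zᴴ) * Uᴴ) := by
          simp only [Matrix.mul_assoc, conjTranspose_mul, conjTranspose_conjTranspose]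
      _ = _ := by
          rw [trace_mul_cycle, hU, hV]
          simp only [Matrix.one_mul, Matrix.mul_one]
  have h3 : trace ((U * Z * Vᴴ)ᴴ * (U * diagonal (fun i => (p i : ℂ)) * Uᴴ) * (U * Z * Vᴴ)) =
      trace (Zᴴ * diagonal (fun i => (p i : ℂ)) * Z) := by
    calc _ = trace (V * (Zᴴ * (Uᴴ * U) * diagonal (fun i => (p i : ℂ)) * (Uᴴ * U) * Z) * Vᴴ) := by
          simp only [Matrix.mul_assoc, conjTranspose_mul, conjTranspose_conjTranspose]
      _ = _ := by
          rw [trace_mul_cycle, hU, hV]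
          simp only [Matrix.one_mul, Matrix.mul_one]
  have e1 : (trace (diagonal (fun i => (p i : ℂ)) * Z * (Uᴴ * V)ᴴ)).re =
      ∑ i, ∑ j, p i * (Z i j * (starRingEnd ℂ) ((Uᴴ * V) i j)).re := by
    rw [trace, Complex.re_sum]
    refine Finset.sum_congr rfl fun i _ => ?_
    rw [diag_apply, mul_apply, Complex.re_sum]
    refine Finset.sum_congr rfl fun j _ => ?_
    rw [diagonal_mul, conjTranspose_apply, mul_assoc, Complex.re_ofReal_mul]
    rfl
  have e2 : (trace (Z * diagonal (fun i => (q i : ℂ)) * Zᴴ)).re =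
      ∑ i, ∑ j, q j * Complex.normSq (Z i j) := by
    rw [trace, Complex.re_sum]
    refine Finset.sum_congr rfl fun i _ => ?_
    rw [diag_apply, mul_apply, Complex.re_sum]
    refine Finset.sum_congr rfl fun j _ => ?_
    rw [mul_diagonal, conjTranspose_apply, mul_right_comm, Complex.star_def, Complex.mul_conj,
      ← Complex.ofReal_mul, Complex.ofReal_re, mul_comm]
  have e3 : (trace (Zᴴ * diagonal (fun i => (p i : ℂ)) * Z)).re =
      ∑ i, ∑ j, p i * Complex.normSq (Z i j) := by
    rw [trace, Complex.re_sum, Finset.sum_comm]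
    refine Finset.sum_congr rfl fun j _ => ?_
    rw [diag_apply, mul_apply, Complex.re_sum]
    refine Finset.sum_congr rfl fun i _ => ?_
    rw [mul_diagonal, conjTranspose_apply, mul_right_comm, Complex.star_def,
      ← Complex.normSq_eq_conj_mul_self, ← Complex.ofReal_mul, Complex.ofReal_re, mul_comm]
  rw [quadFun, h1, h2, h3, e1, e2, e3]
  simp only [Finset.mul_sum, ← Finset.sum_sub_distrib]
  refine Finset.sum_congr rfl fun i _ => Finset.sum_congr rfl fun j _ => ?_
  ring

lemma two_mul_re_sub_le {p q t : ℝ} (hp : 0 ≤ p) (hq : 0 ≤ q) (ht : 0 < t) (z c : ℂ) :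
    2 * p * (z * (starRingEnd ℂ) c).re - (q + t * p) * Complex.normSq z ≤
      p * Complex.normSq c * (p / (q + t * p)) := by
  rcases hp.eq_or_lt with rfl | hp
  · have := mul_nonneg hq (Complex.normSq_nonneg z)
    simpa using this
  · have hd : 0 < q + t * p := by positivity
    have hsq := Complex.normSq_nonneg (((q + t * p : ℝ) : ℂ) * z - (p : ℂ) * c)
    rw [Complex.normSq_sub, Complex.normSq_mul, Complex.normSq_mul, Complex.normSq_ofReal,
      Complex.normSq_ofReal] at hsq
    have hre : (((q + t * p : ℝ) : ℂ) * z * (starRingEnd ℂ) ((p : ℂ) * c)).re =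
        (q + t * p) * p * (z * (starRingEnd ℂ) c).re := by
      rw [map_mul, Complex.conj_ofReal, ← Complex.re_ofReal_mul]
      push_cast
      congr 1
      ring
    rw [hre] at hsq
    rw [← mul_div_assoc, le_div_iff₀ hd]
    nlinarith

lemma two_mul_re_sub_eq {p q t : ℝ} (hp : 0 ≤ p) (hq : 0 ≤ q) (ht : 0 < t) (c : ℂ) :
    2 * p * ((((p / (q + t * p) : ℝ) : ℂ) * c) * (starRingEnd ℂ) c).re -
        (q + t * p) * Complex.normSq (((p / (q + t * p) : ℝ) : ℂ) * c) =
      p * Complex.normSq c * (p / (q + t * p)) := by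
  rcases hp.eq_or_lt with rfl | hp
  · simp
  · have hd : 0 < q + t * p := by positivity
    rw [mul_assoc _ c, Complex.mul_conj, ← Complex.ofReal_mul, Complex.ofReal_re,
      Complex.normSq_mul, Complex.normSq_ofReal]
    field_simp
    ring

lemma quadFun_le [DecidableEq k] {U V : Matrix k k ℂ} (hU : Uᴴ * U = 1)
    (hU' : U * Uᴴ = 1) (hV : Vᴴ * V = 1) (hV' : V * Vᴴ = 1) {p q : k → ℝ} (hp : ∀ i, 0 ≤ p i)
    (hq : ∀ i, 0 ≤ q i) {t : ℝ} (ht : 0 < t) (X : Matrix k k ℂ) :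
    quadFun (U * diagonal (fun i => (p i : ℂ)) * Uᴴ) (V * diagonal (fun i => (q i : ℂ)) * Vᴴ) t
      X ≤ ∑ i, ∑ j, p i * Complex.normSq ((Uᴴ * V) i j) * (p i / (q j + t * p i)) := by
  have hX : X = U * (Uᴴ * X * V) * Vᴴ := by
    calc X = (U * Uᴴ) * X * (V * Vᴴ) := by rw [hU', hV', Matrix.one_mul, Matrix.mul_one]
      _ = _ := by simp only [Matrix.mul_assoc]
  rw [hX, quadFun_spectral hU hV]
  exact Finset.sum_le_sum fun i _ => Finset.sum_le_sum fun j _ =>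
    two_mul_re_sub_le (hp i) (hq j) ht _ _

lemma exists_quadFun_eq [DecidableEq k] {U V : Matrix k k ℂ} (hU : Uᴴ * U = 1)
    (hV : Vᴴ * V = 1) {p q : k → ℝ} (hp : ∀ i, 0 ≤ p i)
    (hq : ∀ i, 0 ≤ q i) {t : ℝ} (ht : 0 < t) :
    ∃ X, quadFun (U * diagonal (fun i => (p i : ℂ)) * Uᴴ)
      (V * diagonal (fun i => (q i : ℂ)) * Vᴴ) t X =
        ∑ i, ∑ j, p i * Complex.normSq ((Uᴴ * V) i j) * (p i / (q j + t * p i)) := by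
  refine ⟨U * of (fun i j => ((p i / (q j + t * p i) : ℝ) : ℂ) * (Uᴴ * V) i j) * Vᴴ, ?_⟩
  rw [quadFun_spectral hU hV]
  exact Finset.sum_congr rfl fun i _ => Finset.sum_congr rfl fun j _ =>
    two_mul_re_sub_eq (hp i) (hq j) ht _

end Variational

section Channel

variable {k κ : Type*} [Fintype k] [Fintype κ]

lemma exists_eq_conjTranspose_mul_self [DecidableEq k] {A : Matrix k k ℂ}
    (hA : A.PosSemidef) : ∃ B : Matrix k k ℂ, A = Bᴴ * B := by
  open scoped MatrixOrder in
  exact CStarAlgebra.nonneg_iff_eq_star_mul_self.mp hA.nonneg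

lemma re_trace_mul_nonneg {A B : Matrix k k ℂ} (hA : A.PosSemidef) (hB : B.PosSemidef) :
    0 ≤ (trace (A * B)).re := by
  classical
  obtain ⟨C, rfl⟩ := exists_eq_conjTranspose_mul_self hB
  rw [← Matrix.mul_assoc, trace_mul_comm, ← Matrix.mul_assoc]
  exact (Complex.le_def.1 (hA.mul_mul_conjTranspose_same C).trace_nonneg).1

/-- The Kadison–Schwarz inequality for a unital map in Kraus form. -/
lemma posSemidef_kraus_schwarz [DecidableEq k] (K : κ → Matrix k k ℂ)
    (hK : ∑ c, (K c)ᴴ * K c = 1) (Y : Matrix k k ℂ) :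
    (∑ c, (K c)ᴴ * (Yᴴ * Y) * K c -
      (∑ c, (K c)ᴴ * Y * K c)ᴴ * (∑ c, (K c)ᴴ * Y * K c)).PosSemidef := by
  set X := ∑ c, (K c)ᴴ * Y * K c with hX
  have hXh : Xᴴ = ∑ c, (K c)ᴴ * Yᴴ * K c := by
    simp [hX, conjTranspose_sum, conjTranspose_mul, Matrix.mul_assoc]
  have h : ∑ c, (K c)ᴴ * (Yᴴ * Y) * K c - Xᴴ * X =
      ∑ c, (Y * K c - K c * X)ᴴ * (Y * K c - K c * X) := by
    have h1 : ∀ c, (Y * K c - K c * X)ᴴ * (Y * K c - K c * X) =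
        (K c)ᴴ * (Yᴴ * Y) * K c - ((K c)ᴴ * Yᴴ * K c) * X - Xᴴ * ((K c)ᴴ * Y * K c) +
          Xᴴ * ((K c)ᴴ * K c) * X := by
      intro c
      simp only [conjTranspose_sub, conjTranspose_mul]
      noncomm_ring
    simp only [h1, Finset.sum_add_distrib, Finset.sum_sub_distrib, ← Finset.sum_mul,
      ← Finset.mul_sum, ← hX, ← hXh, hK]
    noncomm_ring
  rw [h]
  exact posSemidef_sum _ fun c _ => posSemidef_conjTranspose_mul_self _

lemma trace_kraus_mul (K : κ → Matrix k k ℂ) (ρ Y : Matrix k k ℂ) :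
    trace ((∑ c, K c * ρ * (K c)ᴴ) * Y) = trace (ρ * ∑ c, (K c)ᴴ * Y * K c) := by
  simp only [Finset.sum_mul, Finset.mul_sum, trace_sum]
  refine Finset.sum_congr rfl fun c _ => ?_
  rw [Matrix.mul_assoc, Matrix.mul_assoc, trace_mul_comm]
  simp only [Matrix.mul_assoc]

lemma quadFun_kraus_le [DecidableEq k] (K : κ → Matrix k k ℂ)
    (hK : ∑ c, (K c)ᴴ * K c = 1) {ρ σ : Matrix k k ℂ} (hρ : ρ.PosSemidef) (hσ : σ.PosSemidef)
    {t : ℝ} (ht : 0 ≤ t) (Y : Matrix k k ℂ) :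
    quadFun (∑ c, K c * ρ * (K c)ᴴ) (∑ c, K c * σ * (K c)ᴴ) t Y ≤
      quadFun ρ σ t (∑ c, (K c)ᴴ * Y * K c) := by
  set X := ∑ c, (K c)ᴴ * Y * K c with hX
  have hXh : Xᴴ = ∑ c, (K c)ᴴ * Yᴴ * K c := by
    simp [hX, conjTranspose_sum, conjTranspose_mul, Matrix.mul_assoc]
  have h1 := re_trace_mul_nonneg hσ (posSemidef_kraus_schwarz K hK Y)
  have h2 := re_trace_mul_nonneg hρ (posSemidef_kraus_schwarz K hK Yᴴ)
  rw [← hX] at h1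
  rw [← hXh, conjTranspose_conjTranspose, conjTranspose_conjTranspose] at h2
  rw [mul_sub, trace_sub, Complex.sub_re, ← trace_kraus_mul] at h1 h2
  have c1 : ∀ (A τ : Matrix k k ℂ), trace (A * τ * Aᴴ) = trace (τ * (Aᴴ * A)) := fun A τ => by
    rw [trace_mul_cycle, trace_mul_comm]
  have c2 : ∀ (A τ : Matrix k k ℂ), trace (Aᴴ * τ * A) = trace (τ * (A * Aᴴ)) := fun A τ => by
    rw [trace_mul_cycle, trace_mul_comm]
  rw [quadFun, quadFun, c1, c2, c1, c2, trace_kraus_mul K ρ Y]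
  have h3 := mul_nonneg ht h2
  linarith

end Channel

section PartialTrace

variable {a b : Type*}

lemma ptrace₂_sum [Fintype b] {κ : Type*} [Fintype κ] (F : κ → Matrix (a × b) (a × b) ℂ) :
    ptrace₂ (∑ c, F c) = ∑ c, ptrace₂ (F c) := by
  ext x x'
  simp only [ptrace₂, of_apply, Matrix.sum_apply]
  exact Finset.sum_comm

lemma ptrace₁_sum [Fintype a] {κ : Type*} [Fintype κ] (F : κ → Matrix (a × b) (a × b) ℂ) :
    ptrace₁ (∑ c, F c) = ∑ c, ptrace₁ (F c) := by
  ext x x'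
  simp only [ptrace₁, of_apply, Matrix.sum_apply]
  exact Finset.sum_comm

lemma posSemidef_ptrace₂ [Fintype b] {Γ : Matrix (a × b) (a × b) ℂ} (hΓ : Γ.PosSemidef) :
    (ptrace₂ Γ).PosSemidef := by
  have : ptrace₂ Γ = ∑ y, Γ.submatrix (fun x => (x, y)) (fun x => (x, y)) := by
    ext x x'
    simp [ptrace₂, Matrix.sum_apply]
  rw [this]
  exact posSemidef_sum _ fun y _ => hΓ.submatrix _

lemma posSemidef_ptrace₁ [Fintype a] {Γ : Matrix (a × b) (a × b) ℂ} (hΓ : Γ.PosSemidef) :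
    (ptrace₁ Γ).PosSemidef := by
  have : ptrace₁ Γ = ∑ x, Γ.submatrix (fun y => (x, y)) (fun y => (x, y)) := by
    ext y y'
    simp [ptrace₁, Matrix.sum_apply]
  rw [this]
  exact posSemidef_sum _ fun x _ => hΓ.submatrix _

variable [Fintype a] [Fintype b]

lemma kronecker_one_mul_apply [DecidableEq b] (S : Matrix a a ℂ) (Γ : Matrix (a × b) (a × b) ℂ)
    (x : a) (y : b) (w : a × b) :
    ((S ⊗ₖ (1 : Matrix b b ℂ)) * Γ) (x, y) w = ∑ z, S x z * Γ (z, y) w := by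
  simp [mul_apply, Fintype.sum_prod_type, one_apply]

lemma mul_kronecker_one_apply [DecidableEq b] (S : Matrix a a ℂ) (Γ : Matrix (a × b) (a × b) ℂ)
    (x : a) (y : b) (w : a × b) :
    (Γ * (S ⊗ₖ (1 : Matrix b b ℂ))) w (x, y) = ∑ z, Γ w (z, y) * S z x := by
  simp [mul_apply, Fintype.sum_prod_type, one_apply]

lemma one_kronecker_mul_apply [DecidableEq a] (T : Matrix b b ℂ) (Γ : Matrix (a × b) (a × b) ℂ)
    (x : a) (y : b) (w : a × b) :
    (((1 : Matrix a a ℂ) ⊗ₖ T) * Γ) (x, y) w = ∑ z, T y z * Γ (x, z) w := by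
  simp [mul_apply, Fintype.sum_prod_type, one_apply]

lemma mul_one_kronecker_apply [DecidableEq a] (T : Matrix b b ℂ) (Γ : Matrix (a × b) (a × b) ℂ)
    (x : a) (y : b) (w : a × b) :
    (Γ * ((1 : Matrix a a ℂ) ⊗ₖ T)) w (x, y) = ∑ z, Γ w (x, z) * T z y := by
  simp [mul_apply, Fintype.sum_prod_type, one_apply]

lemma ptrace₂_conj_left [DecidableEq b] (S S' : Matrix a a ℂ) (Γ : Matrix (a × b) (a × b) ℂ) :
    ptrace₂ ((S ⊗ₖ (1 : Matrix b b ℂ)) * Γ * (S' ⊗ₖ (1 : Matrix b b ℂ))) =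
      S * ptrace₂ Γ * S' := by
  ext x x'
  simp only [ptrace₂, of_apply, mul_kronecker_one_apply, kronecker_one_mul_apply]
  simp only [of_apply, mul_apply, Finset.mul_sum, Finset.sum_mul]
  rw [Finset.sum_comm]
  exact Finset.sum_congr rfl fun _ _ => Finset.sum_comm

lemma ptrace₁_conj_right [DecidableEq a] (T T' : Matrix b b ℂ) (Γ : Matrix (a × b) (a × b) ℂ) :
    ptrace₁ (((1 : Matrix a a ℂ) ⊗ₖ T) * Γ * ((1 : Matrix a a ℂ) ⊗ₖ T')) =
      T * ptrace₁ Γ * T' := by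
  ext x x'
  simp only [ptrace₁, of_apply, mul_one_kronecker_apply, one_kronecker_mul_apply]
  simp only [of_apply, mul_apply, Finset.mul_sum, Finset.sum_mul]
  rw [Finset.sum_comm]
  exact Finset.sum_congr rfl fun _ _ => Finset.sum_comm

lemma ptrace₂_one_kronecker_mul [DecidableEq a] (T : Matrix b b ℂ) (Γ : Matrix (a × b) (a × b) ℂ) :
    ptrace₂ (((1 : Matrix a a ℂ) ⊗ₖ T) * Γ) = ptrace₂ (Γ * ((1 : Matrix a a ℂ) ⊗ₖ T)) := by
  ext x x'
  simp only [ptrace₂, of_apply, mul_one_kronecker_apply, one_kronecker_mul_apply]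
  rw [Finset.sum_comm]
  simp only [mul_comm]

lemma ptrace₁_kronecker_one_mul [DecidableEq b] (S : Matrix a a ℂ) (Γ : Matrix (a × b) (a × b) ℂ) :
    ptrace₁ ((S ⊗ₖ (1 : Matrix b b ℂ)) * Γ) = ptrace₁ (Γ * (S ⊗ₖ (1 : Matrix b b ℂ))) := by
  ext x x'
  simp only [ptrace₁, of_apply, mul_kronecker_one_apply, kronecker_one_mul_apply]
  rw [Finset.sum_comm]
  simp only [mul_comm]

variable [DecidableEq a] [DecidableEq b]

lemma ptrace₂_conj_kronecker {S S' : Matrix a a ℂ} {T T' : Matrix b b ℂ}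
    (hT : T' * T = 1) (Γ : Matrix (a × b) (a × b) ℂ) :
    ptrace₂ ((S ⊗ₖ T) * Γ * (S' ⊗ₖ T')) = S * ptrace₂ Γ * S' := by
  have h1 : S ⊗ₖ T = ((1 : Matrix a a ℂ) ⊗ₖ T) * (S ⊗ₖ (1 : Matrix b b ℂ)) := by
    simp [← mul_kronecker_mul]
  have h2 : (S' ⊗ₖ T') * ((1 : Matrix a a ℂ) ⊗ₖ T) = S' ⊗ₖ (1 : Matrix b b ℂ) := by
    simp [← mul_kronecker_mul, hT]
  rw [h1, Matrix.mul_assoc, Matrix.mul_assoc, ptrace₂_one_kronecker_mul, Matrix.mul_assoc,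
    Matrix.mul_assoc, h2, ← Matrix.mul_assoc, ptrace₂_conj_left]

lemma ptrace₁_conj_kronecker {S S' : Matrix a a ℂ} {T T' : Matrix b b ℂ}
    (hS : S' * S = 1) (Γ : Matrix (a × b) (a × b) ℂ) :
    ptrace₁ ((S ⊗ₖ T) * Γ * (S' ⊗ₖ T')) = T * ptrace₁ Γ * T' := by
  have h1 : S ⊗ₖ T = (S ⊗ₖ (1 : Matrix b b ℂ)) * ((1 : Matrix a a ℂ) ⊗ₖ T) := by
    simp [← mul_kronecker_mul]
  have h2 : (S' ⊗ₖ T') * (S ⊗ₖ (1 : Matrix b b ℂ)) = (1 : Matrix a a ℂ) ⊗ₖ T' := by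
    simp [← mul_kronecker_mul, hS]
  rw [h1, Matrix.mul_assoc, Matrix.mul_assoc, ptrace₁_kronecker_one_mul, Matrix.mul_assoc,
    Matrix.mul_assoc, h2, ← Matrix.mul_assoc, ptrace₁_conj_right]

lemma conj_diagonal_apply_self {k : Type*} [Fintype k] [DecidableEq k]
    (C : Matrix k k ℂ) (p : k → ℝ) (l : k) :
    (Cᴴ * diagonal (fun i => (p i : ℂ)) * C) l l =
      ((∑ i, p i * Complex.normSq (C i l) : ℝ) : ℂ) := by
  rw [mul_apply, Complex.ofReal_sum]
  refine Finset.sum_congr rfl fun i _ => ?_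
  rw [mul_diagonal, conjTranspose_apply, mul_right_comm, Complex.star_def,
    ← Complex.normSq_eq_conj_mul_self, ← Complex.ofReal_mul, mul_comm]

lemma conj_diagonal_conj_apply_self {k : Type*} [Fintype k] [DecidableEq k]
    {W A : Matrix k k ℂ} {r : k → ℝ} (hW : Wᴴ * W = 1)
    (hA : A = W * diagonal (fun i => (r i : ℂ)) * Wᴴ) (j : k) :
    (Wᴴ * A * W) j j = (r j : ℂ) := by
  have : Wᴴ * A * W = (Wᴴ * W) * diagonal (fun i => (r i : ℂ)) * (Wᴴ * W) := by
    rw [hA]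
    simp only [Matrix.mul_assoc]
  rw [this, hW, Matrix.one_mul, Matrix.mul_one, diagonal_apply_eq]

lemma sum_normSq_row {k : Type*} [Fintype k] [DecidableEq k]
    {C : Matrix k k ℂ} (hC : C * Cᴴ = 1) (i : k) : ∑ l, Complex.normSq (C i l) = 1 := by
  have h := congrFun (congrFun hC i) i
  simp only [mul_apply, conjTranspose_apply, Complex.star_def, Complex.mul_conj,
    one_apply_eq] at h
  exact_mod_cast h

/-- The mutual information of `Γ` in terms of the spectral data of `Γ` and of the product of its
marginals. -/
lemma exists_spectral_mutualInfo {Γ : Matrix (a × b) (a × b) ℂ} (hΓ : Γ.PosSemidef) :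
    ∃ (U V : Matrix (a × b) (a × b) ℂ) (p q : a × b → ℝ),
      Uᴴ * U = 1 ∧ U * Uᴴ = 1 ∧ Vᴴ * V = 1 ∧ V * Vᴴ = 1 ∧
      Γ = U * diagonal (fun i => (p i : ℂ)) * Uᴴ ∧
      ptrace₂ Γ ⊗ₖ ptrace₁ Γ = V * diagonal (fun i => (q i : ℂ)) * Vᴴ ∧
      (∀ i, 0 ≤ p i) ∧ (∀ l, 0 ≤ q l) ∧
      (∀ i l, q l = 0 → p i * Complex.normSq ((Uᴴ * V) i l) = 0) ∧
      ∑ i, ∑ l, p i * Complex.normSq ((Uᴴ * V) i l) = (trace Γ).re ∧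
      vNEntropy (ptrace₂ Γ) + vNEntropy (ptrace₁ Γ) - vNEntropy Γ =
        ∑ i, ∑ l, p i * Complex.normSq ((Uᴴ * V) i l) * (Real.log (p i) - Real.log (q l)) := by
  obtain ⟨U, p, hU, hU', hΓs, hp, hS⟩ := exists_spectral hΓ
  obtain ⟨VA, α, hVA, hVA', hA, hα, hSA⟩ := exists_spectral (posSemidef_ptrace₂ hΓ)
  obtain ⟨VB, β, hVB, hVB', hB, hβ, hSB⟩ := exists_spectral (posSemidef_ptrace₁ hΓ)
  set V := VA ⊗ₖ VB with hVdef
  have hV : Vᴴ * V = 1 := by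
    rw [hVdef, conjTranspose_kronecker, ← mul_kronecker_mul, hVA, hVB, one_kronecker_one]
  have hV' : V * Vᴴ = 1 := by
    rw [hVdef, conjTranspose_kronecker, ← mul_kronecker_mul, hVA', hVB', one_kronecker_one]
  set w : a × b → a × b → ℝ := fun i l => p i * Complex.normSq ((Uᴴ * V) i l) with hw
  have hw0 : ∀ i l, 0 ≤ w i l := fun i l => mul_nonneg (hp i) (Complex.normSq_nonneg _)
  have hrow : ∀ i, ∑ l, w i l = p i := fun i => by
    rw [hw, ← Finset.mul_sum, sum_normSq_row, mul_one]
    rw [conjTranspose_mul, conjTranspose_conjTranspose, Matrix.mul_assoc, ← Matrix.mul_assoc V,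
      hV', Matrix.one_mul, hU]
  have hcol : ∀ l, (Vᴴ * Γ * V) l l = ((∑ i, w i l : ℝ) : ℂ) := fun l => by
    rw [hw, ← conj_diagonal_apply_self, hΓs]
    simp only [conjTranspose_mul, conjTranspose_conjTranspose, Matrix.mul_assoc]
  have hmargA : ∀ j, ∑ y, ∑ i, w i (j, y) = α j := fun j => by
    have h1 : ptrace₂ (Vᴴ * Γ * V) j j = (α j : ℂ) := by
      rw [hVdef, conjTranspose_kronecker, ptrace₂_conj_kronecker hVB']
      exact conj_diagonal_conj_apply_self hVA hA j
    rw [ptrace₂, of_apply] at h1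
    simp only [hcol] at h1
    exact_mod_cast h1
  have hmargB : ∀ y, ∑ j, ∑ i, w i (j, y) = β y := fun y => by
    have h1 : ptrace₁ (Vᴴ * Γ * V) y y = (β y : ℂ) := by
      rw [hVdef, conjTranspose_kronecker, ptrace₁_conj_kronecker hVA']
      exact conj_diagonal_conj_apply_self hVB hB y
    rw [ptrace₁, of_apply] at h1
    simp only [hcol] at h1
    exact_mod_cast h1
  have hwA : ∀ i j y, α j = 0 → w i (j, y) = 0 := fun i j y h => by
    rw [← hmargA, Finset.sum_eq_zero_iff_of_nonneg
      fun _ _ => Finset.sum_nonneg fun _ _ => hw0 _ _] at h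
    exact (Finset.sum_eq_zero_iff_of_nonneg fun _ _ => hw0 _ _).1 (h y (Finset.mem_univ _)) i
      (Finset.mem_univ _)
  have hwB : ∀ i j y, β y = 0 → w i (j, y) = 0 := fun i j y h => by
    rw [← hmargB, Finset.sum_eq_zero_iff_of_nonneg
      fun _ _ => Finset.sum_nonneg fun _ _ => hw0 _ _] at h
    exact (Finset.sum_eq_zero_iff_of_nonneg fun _ _ => hw0 _ _).1 (h j (Finset.mem_univ _)) i
      (Finset.mem_univ _)
  refine ⟨U, V, p, fun l => α l.1 * β l.2, hU, hU', hV, hV', hΓs, ?_, hp,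
    fun l => mul_nonneg (hα _) (hβ _), ?_, ?_, ?_⟩
  · conv_lhs => rw [hA, hB]
    rw [mul_kronecker_mul, mul_kronecker_mul, diagonal_kronecker_diagonal,
      ← conjTranspose_kronecker]
    simp only [Complex.ofReal_mul, hVdef]
  · rintro i ⟨j, y⟩ h
    exact (mul_eq_zero.1 h).elim (hwA i j y) (hwB i j y)
  · rw [Finset.sum_congr rfl fun i _ => hrow i]
    conv_rhs => rw [hΓs]
    rw [trace_mul_cycle, hU, Matrix.one_mul, trace_diagonal, ← Complex.ofReal_sum,
      Complex.ofReal_re]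
  · have hsplit : ∀ i l, w i l * (Real.log (p i) - Real.log (α l.1 * β l.2)) =
        w i l * Real.log (p i) - w i l * Real.log (α l.1) - w i l * Real.log (β l.2) := by
      rintro i ⟨j, y⟩
      by_cases h1 : α j = 0
      · simp [hwA i j y h1]
      by_cases h2 : β y = 0
      · simp [hwB i j y h2]
      rw [Real.log_mul h1 h2]
      ring
    have hsA : ∑ i, ∑ l, w i l * Real.log (α l.1) = ∑ j, α j * Real.log (α j) := by
      rw [Finset.sum_comm, Fintype.sum_prod_type]
      exact Finset.sum_congr rfl fun j _ => by simp only [← Finset.sum_mul, hmargA]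
    have hsB : ∑ i, ∑ l, w i l * Real.log (β l.2) = ∑ y, β y * Real.log (β y) := by
      rw [Finset.sum_comm, Fintype.sum_prod_type_right]
      exact Finset.sum_congr rfl fun j _ => by simp only [← Finset.sum_mul, hmargB]
    have hsp : ∑ i, ∑ l, w i l * Real.log (p i) = ∑ i, p i * Real.log (p i) :=
      Finset.sum_congr rfl fun i _ => by rw [← Finset.sum_mul, hrow]
    change _ = ∑ i, ∑ l, w i l * (Real.log (p i) - Real.log (α l.1 * β l.2))
    simp only [hsplit, Finset.sum_sub_distrib, hsA, hsB, hsp, hS, hSA, hSB]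
    ring

/-- Mutual information decreases under a local channel in Kraus form on the second factor. -/
theorem mutualInfo_kraus_le {κ : Type*} [Fintype κ] {Γ : Matrix (a × b) (a × b) ℂ}
    (hΓ : Γ.PosSemidef) (L : κ → Matrix b b ℂ) (hL : ∑ c, (L c)ᴴ * L c = 1)
    {Γ' : Matrix (a × b) (a × b) ℂ}
    (hΓ' : Γ' = ∑ c, ((1 : Matrix a a ℂ) ⊗ₖ L c) * Γ * ((1 : Matrix a a ℂ) ⊗ₖ L c)ᴴ) :
    vNEntropy (ptrace₂ Γ') + vNEntropy (ptrace₁ Γ') - vNEntropy Γ' ≤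
      vNEntropy (ptrace₂ Γ) + vNEntropy (ptrace₁ Γ) - vNEntropy Γ := by
  have hone : ∑ c, (1 : Matrix a a ℂ) ⊗ₖ ((L c)ᴴ * L c) = 1 := by
    rw [← one_kronecker_one, ← hL]
    ext x y
    simp [Matrix.sum_apply, Finset.mul_sum]
  have hK : ∑ c, ((1 : Matrix a a ℂ) ⊗ₖ L c)ᴴ * ((1 : Matrix a a ℂ) ⊗ₖ L c) = 1 := by
    simpa only [conjTranspose_kronecker, ← mul_kronecker_mul, conjTranspose_one,
      Matrix.one_mul] using hone
  have hpos : Γ'.PosSemidef := by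
    rw [hΓ']
    exact posSemidef_sum _ fun c _ => hΓ.mul_mul_conjTranspose_same _
  have h₂ : ptrace₂ Γ' = ptrace₂ Γ := by
    rw [hΓ', ptrace₂_sum]
    have : ∀ c, ptrace₂ (((1 : Matrix a a ℂ) ⊗ₖ L c) * Γ * ((1 : Matrix a a ℂ) ⊗ₖ L c)ᴴ) =
        ptrace₂ (Γ * ((1 : Matrix a a ℂ) ⊗ₖ ((L c)ᴴ * L c))) := fun c => by
      rw [Matrix.mul_assoc, ptrace₂_one_kronecker_mul, Matrix.mul_assoc, conjTranspose_kronecker,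
        ← mul_kronecker_mul, conjTranspose_one, Matrix.one_mul]
    simp only [this, ← ptrace₂_sum, ← Finset.mul_sum, hone, Matrix.mul_one]
  have h₁ : ptrace₁ Γ' = ∑ c, L c * ptrace₁ Γ * (L c)ᴴ := by
    rw [hΓ', ptrace₁_sum]
    simp only [conjTranspose_kronecker, conjTranspose_one, ptrace₁_conj_right]
  have hprod : ptrace₂ Γ' ⊗ₖ ptrace₁ Γ' =
      ∑ c, ((1 : Matrix a a ℂ) ⊗ₖ L c) * (ptrace₂ Γ ⊗ₖ ptrace₁ Γ) *
        ((1 : Matrix a a ℂ) ⊗ₖ L c)ᴴ := by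
    rw [h₂, h₁]
    simp only [conjTranspose_kronecker, ← mul_kronecker_mul, conjTranspose_one, Matrix.one_mul,
      Matrix.mul_one]
    ext x y
    simp [Matrix.sum_apply, Finset.mul_sum]
  have htr : trace Γ' = trace Γ := by
    have h := trace_kraus_mul (fun c => (1 : Matrix a a ℂ) ⊗ₖ L c) Γ 1
    simpa only [Matrix.mul_one, hK, ← hΓ'] using h
  have hσ := (posSemidef_ptrace₂ hΓ).kronecker (posSemidef_ptrace₁ hΓ)
  have hquad : ∀ {t : ℝ}, 0 ≤ t → ∀ Y, ∃ X,
      quadFun Γ' (ptrace₂ Γ' ⊗ₖ ptrace₁ Γ') t Y ≤ quadFun Γ (ptrace₂ Γ ⊗ₖ ptrace₁ Γ) t X := by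
    intro t ht Y
    rw [hprod, hΓ']
    exact ⟨_, quadFun_kraus_le _ hK hΓ hσ ht Y⟩
  obtain ⟨U, V, p, q, hU, hU', hV, hV', hs, hsσ, hp, hq, hzero, hsum, hI⟩ :=
    exists_spectral_mutualInfo hΓ
  obtain ⟨U₁, V₁, p₁, q₁, hU₁, hU₁', hV₁, hV₁', hs₁, hsσ₁, hp₁, hq₁, hzero₁, hsum₁, hI₁⟩ :=
    exists_spectral_mutualInfo hpos
  rw [hI, hI₁]
  simp only [← Fintype.sum_prod_type'] at hsum hsum₁ ⊢
  refine sum_log_sub_le_of_forall_pos _ (fun i : (a × b) × (a × b) => p i.1) (fun i => q i.2) _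
    (fun i : (a × b) × (a × b) => p₁ i.1) (fun i => q₁ i.2) ?_ ?_ ?_ ?_ ?_ ?_
  · exact fun i h => (hp _).lt_of_ne' (left_ne_zero_of_mul h)
  · exact fun i h => (hq _).lt_of_ne' fun h0 => h (hzero _ _ h0)
  · exact fun i h => (hp₁ _).lt_of_ne' (left_ne_zero_of_mul h)
  · exact fun i h => (hq₁ _).lt_of_ne' fun h0 => h (hzero₁ _ _ h0)
  · rw [hsum, hsum₁, htr]
  · intro t ht
    obtain ⟨Y, hY⟩ := exists_quadFun_eq hU₁ hV₁ hp₁ hq₁ ht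
    obtain ⟨X, hX⟩ := hquad ht.le Y
    have hle := quadFun_le hU hU' hV hV' hp hq ht X
    rw [← hs, ← hsσ] at hle
    rw [← hs₁, ← hsσ₁] at hY
    simp only [Fintype.sum_prod_type (γ := ℝ)] at hle hY ⊢
    linarith

end PartialTrace

/-- Mutual information decreases under a local measurement on the second subsystem. -/
theorem mutualInfo_measurement_le {ι : Type*} [Fintype ι] [DecidableEq ι]
    (Γ : Matrix (n × m) (n × m) ℂ) (hΓ : IsDensityMatrix Γ)
    (M : ι → Matrix m m ℂ) (hM : ∀ k, (M k).PosSemidef) (hMsum : ∑ k, M k = 1)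
    (e : ι → m → ℂ)
    (he : ∀ k l, ∑ x, (starRingEnd ℂ) (e k x) * e l x = if k = l then 1 else 0) :
    (fun ρ : Matrix (n × m) (n × m) ℂ =>
        vNEntropy (ptrace₂ ρ) + vNEntropy (ptrace₁ ρ) - vNEntropy ρ)
      (∑ k, (ptrace₂ (((1 : Matrix n n ℂ) ⊗ₖ M k) * Γ)) ⊗ₖ
        Matrix.of (fun x y => e k x * (starRingEnd ℂ) (e k y))) ≤
    vNEntropy (ptrace₂ Γ) + vNEntropy (ptrace₁ Γ) - vNEntropy Γ := by

  choose B hB using fun k => exists_eq_conjTranspose_mul_self (hM k)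
  refine mutualInfo_kraus_le hΓ.1
    (fun c : ι × m => Matrix.of fun y z => e c.1 y * B c.1 c.2 z) ?_ ?_
  · rw [← hMsum, Fintype.sum_prod_type]
    refine Finset.sum_congr rfl fun k _ => ?_
    ext z z'
    have hk := he k k
    rw [if_pos rfl] at hk
    simp only [hB k, Matrix.sum_apply, mul_apply, conjTranspose_apply, of_apply]
    refine Finset.sum_congr rfl fun r _ => ?_
    calc _ = (∑ x, (starRingEnd ℂ) (e k x) * e k x) * (star (B k r z) * B k r z') := by
          rw [Finset.sum_mul]
          refine Finset.sum_congr rfl fun y _ => ?_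
          rw [star_mul', Complex.star_def]
          ring
      _ = _ := by rw [hk, one_mul]
  · rw [Fintype.sum_prod_type]
    refine Finset.sum_congr rfl fun k _ => ?_
    ext ⟨x, y⟩ ⟨x', y'⟩
    simp only [conjTranspose_kronecker, conjTranspose_one, Matrix.sum_apply,
      mul_one_kronecker_apply, one_kronecker_mul_apply, kroneckerMap_apply, ptrace₂, of_apply,
      conjTranspose_apply]
    simp only [hB k, mul_apply, conjTranspose_apply, Finset.sum_mul]
    rw [Finset.sum_comm_cycle]
    refine Finset.sum_congr rfl fun r _ => Finset.sum_congr rfl fun z _ =>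
      Finset.sum_congr rfl fun z' _ => ?_
    rw [star_mul', Complex.star_def]
    ring
end
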